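/- Let E be an L_{∞,λ} space, F a Banach space of finite cotype q, and f : E → F analytic at a ∈ E. Then f is absolutely (q,2)-summing at a: there exist M, δ > 0 with (Σ_{j=1}^m ‖f(a+x_j)-f(a)‖^q)^{1/q} ≤ M ‖(x_j)_{j=1}^m‖_{w,2} for all m and all x_1,...,x_m with ‖(x_j)_{j=1}^m‖_{w,2} < δ. -/

import Mathlib

open MeasureTheory Filter Finset

/-- The weak ℓ_q norm of a finite family: `sup_{‖φ‖≤1} (∑ |φ x_j|^q)^{1/q}`. -/
noncomputable def weakNorm {E : Type*} [NormedAddCommGroup E] [NormedSpace ℝ E]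
    (q : ℝ) {k : ℕ} (x : Fin k → E) : ℝ :=
  sSup {s : ℝ | ∃ φ : E →L[ℝ] ℝ, ‖φ‖ ≤ 1 ∧ s = (∑ j, |φ (x j)| ^ q) ^ (1 / q)}

/-- The weak ℓ_q norm of a sequence. -/
noncomputable def weakNormSeq {E : Type*} [NormedAddCommGroup E] [NormedSpace ℝ E]
    (q : ℝ) (x : ℕ → E) : ℝ :=
  sSup {s : ℝ | ∃ φ : E →L[ℝ] ℝ, ‖φ‖ ≤ 1 ∧ s = (∑' j, |φ (x j)| ^ q) ^ (1 / q)}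

/-- Unconditionally q-summable sequences: weakly q-summable with weak norms of tails → 0. -/
def UncondSummable {E : Type*} [NormedAddCommGroup E] [NormedSpace ℝ E]
    (q : ℝ) (x : ℕ → E) : Prop :=
  (∀ φ : E →L[ℝ] ℝ, Summable fun j => |φ (x j)| ^ q) ∧
    Tendsto (fun m => weakNormSeq q fun j => x (j + m)) atTop (nhds 0)

/-- The Rademacher functions on [0,1]. -/
noncomputable def rademacher (j : ℕ) (t : ℝ) : ℝ :=
  if Int.fract ((2 : ℝ) ^ j * t) < 1 / 2 then 1 else -1

/-- `(∫_0^1 ‖∑_j r_j(t) y_j‖² dt)^{1/2}` for a finite family `y` in `F`. -/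
noncomputable def radNorm {F : Type*} [NormedAddCommGroup F] [NormedSpace ℝ F]
    {k : ℕ} (y : Fin k → F) : ℝ :=
  (∫ t in (0:ℝ)..1, ‖∑ j : Fin k, rademacher (j : ℕ) t • y j‖ ^ 2) ^ ((1:ℝ) / 2)

/-- `f` is almost p-summing at `a`. -/
def AlmostSummingAt {E F : Type*} [NormedAddCommGroup E] [NormedSpace ℝ E]
    [NormedAddCommGroup F] [NormedSpace ℝ F] (p : ℝ) (f : E → F) (a : E) : Prop :=
  ∃ C > 0, ∃ ε > 0, ∃ r > 0, ∀ (k : ℕ) (x : Fin k → E), weakNorm p x < ε →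
    radNorm (fun j => f (a + x j) - f a) ≤ C * weakNorm p x ^ r

/-- `f` is absolutely (p,q)-summing at `a`. -/
def AbsSummingAt {E F : Type*} [NormedAddCommGroup E] [NormedSpace ℝ E]
    [NormedAddCommGroup F] [NormedSpace ℝ F] (p q : ℝ) (f : E → F) (a : E) : Prop :=
  ∃ M > 0, ∃ δ > 0, ∃ r > 0, ∀ (k : ℕ) (x : Fin k → E), weakNorm q x < δ →
    (∑ j, ‖f (a + x j) - f a‖ ^ p) ≤ M * weakNorm q x ^ r

/-- `E` is an `L_{∞,λ}` space: every finite-dimensional subspace is contained in a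
finite-dimensional subspace λ-isomorphic to some `ℓ_∞^m`. -/
def IsLinftySpace (lam : ℝ) (E : Type*) [NormedAddCommGroup E] [NormedSpace ℝ E] : Prop :=
  ∀ G : Subspace ℝ E, FiniteDimensional ℝ G →
    ∃ H : Subspace ℝ E, G ≤ H ∧ FiniteDimensional ℝ H ∧
      ∃ m : ℕ, ∃ e : H ≃L[ℝ] (Fin m → ℝ),
        ‖(e : H →L[ℝ] (Fin m → ℝ))‖ * ‖(e.symm : (Fin m → ℝ) →L[ℝ] H)‖ ≤ lam

/-- Sign attached to a boolean. -/
noncomputable def sg (b : Bool) : ℝ := if b then 1 else -1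

lemma sg_sq (b : Bool) : sg b * sg b = 1 := by cases b <;> simp [sg]

lemma abs_sg (b : Bool) : |sg b| = 1 := by cases b <;> simp [sg]

/-- Averages over the cube of signs. -/
noncomputable def av {m : ℕ} (g : (Fin m → Bool) → ℝ) : ℝ := (2 ^ m : ℝ)⁻¹ * ∑ ε, g ε

lemma av_mono {m : ℕ} {g h : (Fin m → Bool) → ℝ} (H : ∀ ε, g ε ≤ h ε) : av g ≤ av h := by
  unfold av
  gcongr with ε
  exact H ε

lemma av_nonneg {m : ℕ} {g : (Fin m → Bool) → ℝ} (H : ∀ ε, 0 ≤ g ε) : 0 ≤ av g := by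
  unfold av
  have := Finset.sum_nonneg (s := Finset.univ) (fun ε _ => H ε)
  positivity

lemma av_add {m : ℕ} (g h : (Fin m → Bool) → ℝ) : av (fun ε => g ε + h ε) = av g + av h := by
  simp [av, Finset.sum_add_distrib, mul_add]

lemma av_sub {m : ℕ} (g h : (Fin m → Bool) → ℝ) : av (fun ε => g ε - h ε) = av g - av h := by
  simp [av, Finset.sum_sub_distrib, mul_sub]

lemma av_const_mul {m : ℕ} (c : ℝ) (g : (Fin m → Bool) → ℝ) :
    av (fun ε => c * g ε) = c * av g := by
  simp only [av, ← Finset.mul_sum]; ring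

lemma av_const (m : ℕ) (c : ℝ) : av (fun _ : Fin m → Bool => c) = c := by
  simp [av]

lemma av_sum {m : ℕ} {ι : Type*} (s : Finset ι) (g : ι → (Fin m → Bool) → ℝ) :
    av (fun ε => ∑ i ∈ s, g i ε) = ∑ i ∈ s, av (g i) := by
  simp only [av]
  rw [Finset.sum_comm, Finset.mul_sum]

lemma av_prod {m : ℕ} (f : Fin m → Bool → ℝ) :
    av (fun ε => ∏ i, f i (ε i)) = ∏ i, ((f i true + f i false) / 2) := by
  have h := Finset.prod_univ_sum (fun _ : Fin m => (Finset.univ : Finset Bool)) f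
  rw [Fintype.piFinset_univ] at h
  unfold av
  rw [← h]
  simp only [Fintype.sum_bool, Finset.prod_div_distrib, Finset.prod_const, Finset.card_univ,
    Fintype.card_fin]
  field_simp

lemma av_sg_mul {m : ℕ} (i j : Fin m) :
    av (fun ε => sg (ε i) * sg (ε j)) = if i = j then 1 else 0 := by
  split_ifs with h
  · subst h
    simp only [sg_sq]
    exact av_const m 1
  · unfold av
    have : ∑ ε : Fin m → Bool, sg (ε i) * sg (ε j) = 0 := by
      refine Finset.sum_involution (fun ε _ => Function.update ε i (!(ε i))) ?_ ?_ ?_ ?_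
      · intro ε _
        simp only [Function.update_self, Function.update_of_ne (Ne.symm h)]
        cases ε i <;> cases ε j <;> simp [sg]
      · intro ε _ _ h2
        have := congrFun h2 i
        simp at this
      · intro ε _; simp
      · intro ε _; simp
    rw [this, mul_zero]

lemma av_exp_le {m : ℕ} (c : Fin m → ℝ) (hc : ∑ j, c j ^ 2 ≤ 1) (s : ℝ) (hs : s ^ 2 = 1) :
    av (fun ε => Real.exp (s * ∑ j, sg (ε j) * c j)) ≤ 2 := by
  have h1 : (fun ε : Fin m → Bool => Real.exp (s * ∑ j, sg (ε j) * c j))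
      = fun ε => ∏ j, (fun j b => Real.exp (s * (sg b * c j))) j (ε j) := by
    funext ε
    rw [Finset.mul_sum, Real.exp_sum]
  rw [h1, av_prod (fun j b => Real.exp (s * (sg b * c j)))]
  calc ∏ j, ((Real.exp (s * (sg true * c j)) + Real.exp (s * (sg false * c j))) / 2)
      ≤ ∏ j, Real.exp (c j ^ 2 / 2) := by
        refine Finset.prod_le_prod (fun j _ => by positivity) (fun j _ => ?_)
        have := Real.cosh_le_exp_half_sq (s * c j)
        rw [Real.cosh_eq, mul_pow, hs, one_mul] at this
        simpa [sg] using this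
    _ = Real.exp ((∑ j, c j ^ 2) / 2) := by rw [← Real.exp_sum, Finset.sum_div]
    _ ≤ Real.exp (1 / 2) := by gcongr
    _ ≤ 2 := by
        have h := Real.exp_one_lt_d9
        have h2 : Real.exp (1/2) * Real.exp (1/2) = Real.exp 1 := by
          rw [← Real.exp_add]; norm_num
        nlinarith [Real.exp_pos (1/2)]

lemma av_cosh_le {m : ℕ} (c : Fin m → ℝ) (hc : ∑ j, c j ^ 2 ≤ 1) :
    av (fun ε => Real.cosh (∑ j, sg (ε j) * c j)) ≤ 2 := by
  have h1 := av_exp_le c hc 1 (by norm_num)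
  have h2 := av_exp_le c hc (-1) (by norm_num)
  have : (fun ε : Fin m → Bool => Real.cosh (∑ j, sg (ε j) * c j))
    = fun ε => (1/2) * (Real.exp (1 * ∑ j, sg (ε j) * c j)
        + Real.exp (-1 * ∑ j, sg (ε j) * c j)) := by
    funext ε; rw [Real.cosh_eq]; ring_nf
  rw [this, av_const_mul, av_add]
  linarith

lemma bessel {m : ℕ} (h : (Fin m → Bool) → ℝ) :
    ∑ j, (av (fun ε => sg (ε j) * h ε)) ^ 2 ≤ av (fun ε => h ε ^ 2) := by
  set c : Fin m → ℝ := fun j => av (fun ε => sg (ε j) * h ε) with hc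
  have h0 : 0 ≤ av (fun ε => (h ε - ∑ j, c j * sg (ε j)) ^ 2) := av_nonneg fun ε => sq_nonneg _
  have h1 : (fun ε : Fin m → Bool => (h ε - ∑ j, c j * sg (ε j)) ^ 2)
      = fun ε => (h ε ^ 2 - 2 * ∑ j, c j * (sg (ε j) * h ε))
        + ∑ i, ∑ j, (c i * c j) * (sg (ε i) * sg (ε j)) := by
    funext ε
    have e1 : ∑ j, c j * (sg (ε j) * h ε) = (∑ j, c j * sg (ε j)) * h ε := by
      rw [Finset.sum_mul]; exact Finset.sum_congr rfl fun _ _ => by ring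
    have e2 : ∑ i, ∑ j, (c i * c j) * (sg (ε i) * sg (ε j))
        = (∑ j, c j * sg (ε j)) * (∑ j, c j * sg (ε j)) := by
      rw [Finset.sum_mul_sum]
      exact Finset.sum_congr rfl fun _ _ => Finset.sum_congr rfl fun _ _ => by ring
    rw [e1, e2]; ring
  rw [h1, av_add, av_sub, av_const_mul, av_sum, av_sum] at h0
  simp only [av_const_mul, av_sum, av_sg_mul] at h0
  simp only [mul_ite, mul_one, mul_zero, Finset.sum_ite_eq, Finset.mem_univ, if_true] at h0
  change 0 ≤ av (fun ε => h ε ^ 2) - 2 * ∑ i, c i * c i + ∑ i, c i * c i at h0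
  have : ∑ j, c j ^ 2 = ∑ j, c j * c j := Finset.sum_congr rfl fun _ _ => by ring
  linarith

lemma av_succ {m : ℕ} (g : (Fin (m+1) → Bool) → ℝ) :
    av g = (av (fun ε => g (Fin.cons true ε)) + av (fun ε => g (Fin.cons false ε))) / 2 := by
  unfold av
  rw [← (Fin.consEquiv (fun _ : Fin (m+1) => Bool)).sum_comp, Fintype.sum_prod_type]
  simp only [Fintype.sum_bool, Fin.consEquiv, Equiv.coe_fn_mk]
  field_simp
  ring

lemma rad_int (k : ℕ) : ∀ g : (Fin k → ℝ) → ℝ,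
    IntervalIntegrable (fun t => g (fun j => rademacher (j : ℕ) t)) volume 0 1 ∧
    ∫ t in (0:ℝ)..1, g (fun j => rademacher (j : ℕ) t) = av (fun ε => g (fun j => sg (ε j))) := by
  induction k with
  | zero =>
    intro g
    have : ∀ t : ℝ, (fun j : Fin 0 => rademacher (j : ℕ) t) = fun j => j.elim0 := by
      intro t; funext j; exact j.elim0
    have h2 : ∀ ε : Fin 0 → Bool, (fun j : Fin 0 => sg (ε j)) = fun j => j.elim0 := by
      intro t; funext j; exact j.elim0
    simp only [this, h2, av_const]
    simp
  | succ k ih =>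
    intro g
    have hr1 : ∀ (j : ℕ) (t : ℝ), rademacher (j+1) t = rademacher j (2 * t) := by
      intro j t; unfold rademacher; congr 3; ring
    have hr2 : ∀ (j : ℕ) (t : ℝ), rademacher j (t + (-1)) = rademacher j t := by
      intro j t; unfold rademacher
      have : (2:ℝ)^j * (t + (-1)) = 2^j * t - ((2^j : ℕ) : ℝ) := by push_cast; ring
      rw [this, Int.fract_sub_natCast]
    have A : Set.EqOn (fun t => (fun s : ℝ => g (Fin.cons 1 (fun j : Fin k => rademacher (j:ℕ) s))) (2 * t))
        (fun t => g (fun j => rademacher (j : ℕ) t)) (Set.uIoo 0 (1/2)) := by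
      intro t ht
      rw [Set.uIoo_of_le (by norm_num)] at ht
      simp only
      congr 1
      funext j
      refine Fin.cases ?_ (fun i => ?_) j
      · simp only [Fin.cons_zero, Fin.val_zero, rademacher, pow_zero, one_mul]
        rw [Int.fract_eq_self.2 ⟨ht.1.le, by linarith [ht.2]⟩, if_pos ht.2]
      · simp only [Fin.cons_succ, Fin.val_succ, hr1]
    have B : Set.EqOn (fun t => (fun s : ℝ => g (Fin.cons (-1) (fun j : Fin k => rademacher (j:ℕ) s))) (2 * t + (-1)))
        (fun t => g (fun j => rademacher (j : ℕ) t)) (Set.uIoo (1/2) 1) := by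
      intro t ht
      rw [Set.uIoo_of_le (by norm_num)] at ht
      simp only
      congr 1
      funext j
      refine Fin.cases ?_ (fun i => ?_) j
      · simp only [Fin.cons_zero, Fin.val_zero, rademacher, pow_zero, one_mul]
        rw [Int.fract_eq_self.2 ⟨by linarith [ht.1], by linarith [ht.2]⟩, if_neg (not_lt.2 ht.1.le)]
      · simp only [Fin.cons_succ, Fin.val_succ, hr1, hr2]
    obtain ⟨i1, e1⟩ := ih (fun v => g (Fin.cons 1 v))
    obtain ⟨i2, e2⟩ := ih (fun v => g (Fin.cons (-1) v))
    have I1 : IntervalIntegrable (fun t => g (fun j => rademacher (j : ℕ) t)) volume 0 (1/2) := by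
      refine IntervalIntegrable.congr_uIoo ?_ A
      have := i1.comp_mul_left (c := 2)
      simpa using this
    have I2 : IntervalIntegrable (fun t => g (fun j => rademacher (j : ℕ) t)) volume (1/2) 1 := by
      refine IntervalIntegrable.congr_uIoo ?_ B
      have := (i2.comp_add_right (-1)).comp_mul_left (c := 2)
      norm_num at this
      simpa using this
    refine ⟨I1.trans I2, ?_⟩
    rw [← intervalIntegral.integral_add_adjacent_intervals I1 I2,
      ← intervalIntegral.integral_congr_uIoo A, ← intervalIntegral.integral_congr_uIoo B,
      intervalIntegral.integral_comp_mul_left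
        (fun s : ℝ => g (Fin.cons 1 (fun j : Fin k => rademacher (j:ℕ) s))) (by norm_num),
      intervalIntegral.integral_comp_mul_add
        (fun s : ℝ => g (Fin.cons (-1) (fun j : Fin k => rademacher (j:ℕ) s))) (by norm_num)]
    norm_num
    rw [e1, e2, av_succ]
    have hc : ∀ (b : Bool) (ε : Fin k → Bool),
        (fun j => sg ((Fin.cons b ε : Fin (k+1) → Bool) j))
          = (Fin.cons (sg b) (fun j => sg (ε j)) : Fin (k+1) → ℝ) := by
      intro b ε; funext j
      refine Fin.cases ?_ (fun i => ?_) j <;> simp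
    simp only [hc]
    simp only [sg, if_true, Bool.false_eq_true, if_false]
    ring

lemma radNorm_eq {F : Type*} [NormedAddCommGroup F] [NormedSpace ℝ F] {k : ℕ} (y : Fin k → F) :
    radNorm y = (av (fun ε => ‖∑ j, sg (ε j) • y j‖ ^ 2)) ^ ((1:ℝ)/2) := by
  unfold radNorm
  rw [(rad_int k (fun v => ‖∑ j, v j • y j‖ ^ 2)).2]

lemma young_aux {q a b : ℝ} (hq : 2 ≤ q) (ha : 0 ≤ a) (hb : 0 ≤ b) :
    a ^ (q - 1) * b ≤ (1 - 1 / q) * a ^ q + 1 / q * b ^ q := by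
  have hq0 : 0 < q := by linarith
  have h1 : 1 / q ≤ 1 := by rw [div_le_one hq0]; linarith
  have := Real.geom_mean_le_arith_mean2_weighted (w₁ := 1 - 1 / q) (w₂ := 1 / q)
    (p₁ := a ^ q) (p₂ := b ^ q) (by linarith) (by positivity) (by positivity) (by positivity)
    (by ring)
  rw [← Real.rpow_mul ha, ← Real.rpow_mul hb] at this
  have e1 : q * (1 - 1 / q) = q - 1 := by field_simp
  have e2 : q * (1 / q) = 1 := by field_simp
  rwa [e1, e2, Real.rpow_one] at this

/-- Families in `ℓ_∞^n` with weak `ℓ_2` norm at most one. -/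
def Adm {n m : ℕ} (x : Fin m → Fin n → ℝ) : Prop := ∀ t, ∑ j, x j t ^ 2 ≤ 1

lemma Adm.abs_le {n m : ℕ} {x : Fin m → Fin n → ℝ} (hx : Adm x) (j : Fin m) (t : Fin n) :
    |x j t| ≤ 1 := by
  have h1 : x j t ^ 2 ≤ ∑ j, x j t ^ 2 :=
    Finset.single_le_sum (f := fun j => x j t ^ 2) (fun _ _ => sq_nonneg _) (Finset.mem_univ j)
  have := h1.trans (hx t)
  exact (sq_le_one_iff_abs_le_one _).1 this

lemma pisier_step {F : Type*} [NormedAddCommGroup F] [NormedSpace ℝ F] {n : ℕ}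
    (T : (Fin n → ℝ) →L[ℝ] F) {q : ℝ} (hq : 2 ≤ q) {S : ℝ}
    (hS : ∀ (m : ℕ) (x : Fin m → Fin n → ℝ), Adm x → ∑ j, ‖T (x j)‖ ^ q ≤ S)
    {δ : ℝ} {m : ℕ} (x : Fin m → Fin n → ℝ) (hx : Adm x) (hxS : S - δ ≤ ∑ j, ‖T (x j)‖ ^ q) :
    ∃ l : Fin n → ℝ, (∀ t, 0 ≤ l t) ∧ ∑ t, l t ≤ S ∧ ∀ u : Fin n → ℝ, (∀ t, |u t| ≤ 1) →
      ‖T u‖ ^ q ≤ q * (δ + ∑ t, l t * u t ^ 2) := by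
  classical
  have hq0 : 0 < q := by linarith
  have hq1 : 1 / q ≤ 1 := by rw [div_le_one hq0]; linarith
  choose y hy1 hy2 using fun j => exists_dual_vector'' ℝ (T (x j))
  set s := ∑ j, ‖T (x j)‖ ^ q with hs
  have hsS : s ≤ S := hS m x hx
  -- the functional
  let L : (Fin n → ℝ) → ℝ := fun f => ∑ j, ‖T (x j)‖ ^ (q - 1) * y j (T (fun t => x j t * f t))
  let l : Fin n → ℝ := fun t => L (Pi.single t 1)
  have hL : ∀ f, L f = ∑ t, l t * f t := by
    intro f
    simp only [L, l]
    simp only [Finset.sum_mul]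
    rw [Finset.sum_comm]
    refine Finset.sum_congr rfl fun j _ => ?_
    have : (fun t => x j t * f t)
        = ∑ t, f t • (fun t' => x j t' * (Pi.single t (1:ℝ) : Fin n → ℝ) t') := by
      funext t'
      simp [Finset.sum_apply, Pi.single_apply, mul_comm]
    rw [this, map_sum, map_sum, Finset.mul_sum]
    refine Finset.sum_congr rfl fun t _ => ?_
    rw [map_smul, map_smul, smul_eq_mul]; ring
  have hLle : ∀ f, L f ≤ (1 - 1 / q) * s + 1 / q * ∑ j, ‖T (fun t => x j t * f t)‖ ^ q := by
    intro f
    rw [hs, Finset.mul_sum, Finset.mul_sum, ← Finset.sum_add_distrib]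
    refine Finset.sum_le_sum fun j _ => ?_
    refine le_trans ?_ (young_aux hq (norm_nonneg _) (norm_nonneg _))
    refine mul_le_mul_of_nonneg_left ?_ (by positivity)
    refine (le_abs_self _).trans ?_
    have := (y j).le_opNorm (T (fun t => x j t * f t))
    rw [Real.norm_eq_abs] at this
    exact this.trans (mul_le_of_le_one_left (norm_nonneg _) (hy1 j))
  have hL1 : L (fun _ => 1) = s := by
    simp only [L, mul_one, hs]
    refine Finset.sum_congr rfl fun j _ => ?_
    have := hy2 j
    simp only [RCLike.ofReal_real_eq_id, id] at this
    rw [show (fun t => x j t) = x j from rfl, this]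
    by_cases h0 : ‖T (x j)‖ = 0
    · rw [h0, mul_zero, Real.zero_rpow hq0.ne']
    · rw [Real.rpow_sub_one h0, div_mul_cancel₀ _ h0]
  refine ⟨fun t => |l t|, fun t => abs_nonneg _, ?_, ?_⟩
  · -- total mass
    let f : Fin n → ℝ := fun t => if 0 ≤ l t then 1 else -1
    have hf : ∀ t, f t ^ 2 = 1 := by intro t; simp only [f]; split_ifs <;> norm_num
    have h1 : L f = ∑ t, |l t| := by
      rw [hL]
      refine Finset.sum_congr rfl fun t _ => ?_
      simp only [f]
      split_ifs with h
      · rw [abs_of_nonneg h, mul_one]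
      · rw [abs_of_neg (not_le.1 h)]; ring
    have h2 : ∑ j, ‖T (fun t => x j t * f t)‖ ^ q ≤ S := by
      refine hS m (fun j t => x j t * f t) fun t => ?_
      simp only [mul_pow, hf, mul_one]
      exact hx t
    have h3 := hLle f
    rw [h1] at h3
    have h4 : (1 - 1 / q) * s ≤ (1 - 1 / q) * S :=
      mul_le_mul_of_nonneg_left hsS (by linarith)
    have h5 : 1 / q * ∑ j, ‖T (fun t => x j t * f t)‖ ^ q ≤ 1 / q * S :=
      mul_le_mul_of_nonneg_left h2 (by positivity)
    linarith
  · intro u hu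
    have hu2 : ∀ t, u t ^ 2 ≤ 1 := fun t => (sq_le_one_iff_abs_le_one _).2 (hu t)
    let f : Fin n → ℝ := fun t => Real.sqrt (1 - u t ^ 2)
    have hf : ∀ t, f t ^ 2 = 1 - u t ^ 2 := fun t => Real.sq_sqrt (by linarith [hu2 t])
    have hf0 : ∀ t, 0 ≤ f t := fun t => Real.sqrt_nonneg _
    have hf1 : ∀ t, f t ≤ 1 := fun t => Real.sqrt_le_one.2 (by linarith [sq_nonneg (u t)])
    have h2 : ‖T u‖ ^ q + ∑ j, ‖T (fun t => x j t * f t)‖ ^ q ≤ S := by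
      have := hS (m+1) (Fin.cons u (fun j t => x j t * f t)) (fun t => ?_)
      · simpa [Fin.sum_univ_succ] using this
      · simp only [Fin.sum_univ_succ, Fin.cons_zero, Fin.cons_succ, mul_pow, hf, ← Finset.sum_mul]
        nlinarith [hx t, hu2 t]
    have h3 := hLle f
    have h4 : (1 - 1 / q) * s ≤ (1 - 1 / q) * S :=
      mul_le_mul_of_nonneg_left hsS (by linarith)
    have h5 : 1 / q * ∑ j, ‖T (fun t => x j t * f t)‖ ^ q ≤ 1 / q * (S - ‖T u‖ ^ q) :=
      mul_le_mul_of_nonneg_left (by linarith) (by positivity)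
    have h6 : s - L f ≤ ∑ t, |l t| * u t ^ 2 := by
      rw [← hL1, hL, hL, ← Finset.sum_sub_distrib]
      refine Finset.sum_le_sum fun t _ => ?_
      rw [← mul_sub]
      calc l t * (1 - f t) ≤ |l t| * (1 - f t) :=
            mul_le_mul_of_nonneg_right (le_abs_self _) (by linarith [hf1 t])
        _ ≤ |l t| * u t ^ 2 := by
            refine mul_le_mul_of_nonneg_left ?_ (abs_nonneg _)
            nlinarith [hf t, hf0 t, hf1 t]
    have h7 : 1 / q * ‖T u‖ ^ q ≤ δ + ∑ t, |l t| * u t ^ 2 := by linarith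
    calc ‖T u‖ ^ q = q * (1 / q * ‖T u‖ ^ q) := by field_simp
      _ ≤ _ := mul_le_mul_of_nonneg_left h7 hq0.le

lemma pisier {F : Type*} [NormedAddCommGroup F] [NormedSpace ℝ F] {n : ℕ}
    (T : (Fin n → ℝ) →L[ℝ] F) {q : ℝ} (hq : 2 ≤ q) {S : ℝ}
    (hS : ∀ (m : ℕ) (x : Fin m → Fin n → ℝ), Adm x → ∑ j, ‖T (x j)‖ ^ q ≤ S)
    (hS' : ∀ δ > 0, ∃ (m : ℕ) (x : Fin m → Fin n → ℝ), Adm x ∧ S - δ ≤ ∑ j, ‖T (x j)‖ ^ q) :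
    ∃ l : Fin n → ℝ, (∀ t, 0 ≤ l t) ∧ ∑ t, l t ≤ S ∧ ∀ u : Fin n → ℝ, (∀ t, |u t| ≤ 1) →
      ‖T u‖ ^ q ≤ q * ∑ t, l t * u t ^ 2 := by
  have H : ∀ k : ℕ, ∃ l : Fin n → ℝ, (∀ t, 0 ≤ l t) ∧ ∑ t, l t ≤ S ∧
      ∀ u : Fin n → ℝ, (∀ t, |u t| ≤ 1) →
      ‖T u‖ ^ q ≤ q * (1 / ((k:ℝ) + 1) + ∑ t, l t * u t ^ 2) := by
    intro k
    obtain ⟨m, x, hx, hxS⟩ := hS' (1 / ((k:ℝ) + 1)) (by positivity)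
    exact pisier_step T hq hS x hx hxS
  choose l h1 h2 h3 using H
  have hmem : ∀ k, l k ∈ Set.Icc (0 : Fin n → ℝ) (fun _ => S) := fun k =>
    ⟨fun t => h1 k t, fun t => (Finset.single_le_sum (f := l k) (fun t _ => h1 k t)
      (Finset.mem_univ t)).trans (h2 k)⟩
  obtain ⟨a, ha, φ, hφ, hlim⟩ := isCompact_Icc.tendsto_subseq hmem
  have hlt : ∀ t, Tendsto (fun k => l (φ k) t) atTop (nhds (a t)) := fun t =>
    (tendsto_pi_nhds.1 hlim) t
  refine ⟨a, fun t => ha.1 t, ?_, fun u hu => ?_⟩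
  · exact le_of_tendsto' (tendsto_finsetSum _ fun t _ => hlt t) fun k => h2 (φ k)
  · have hz : Tendsto (fun k => 1 / (((φ k : ℕ):ℝ) + 1)) atTop (nhds 0) :=
      tendsto_one_div_add_atTop_nhds_zero_nat.comp hφ.tendsto_atTop
    have : Tendsto (fun k => q * (1 / (((φ k : ℕ):ℝ) + 1) + ∑ t, l (φ k) t * u t ^ 2)) atTop
        (nhds (q * (0 + ∑ t, a t * u t ^ 2))) :=
      (hz.add (tendsto_finsetSum _ fun t _ => (hlt t).mul_const _)).const_mul _
    rw [zero_add] at this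
    exact ge_of_tendsto' this fun k => h3 (φ k) u hu

lemma cosh_poly (q : ℝ) (hq : 2 ≤ q) :
    ∃ K > 0, ∀ s : ℝ, 0 ≤ s → s ^ (2 * q) ≤ K * Real.cosh s := by
  obtain ⟨N, hN⟩ := exists_nat_ge (2 * q)
  have hfac : (1:ℝ) ≤ (N.factorial : ℝ) := by exact_mod_cast N.factorial_pos
  refine ⟨2 * N.factorial, by positivity, fun s hs => ?_⟩
  rcases le_total s 1 with h | h
  · have h1 : s ^ (2 * q) ≤ 1 := Real.rpow_le_one hs h (by linarith)
    have h2 := Real.one_le_cosh s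
    nlinarith
  · have h1 : s ^ (2 * q) ≤ s ^ (N : ℝ) := Real.rpow_le_rpow_of_exponent_le h hN
    rw [Real.rpow_natCast] at h1
    have h2 := Real.pow_div_factorial_le_exp s hs N
    rw [div_le_iff₀ (by positivity)] at h2
    have h3 : Real.exp s ≤ 2 * Real.cosh s := by
      rw [Real.cosh_eq]; linarith [Real.exp_pos (-s)]
    nlinarith

section
variable {F : Type*} [NormedAddCommGroup F] [NormedSpace ℝ F]

lemma layer {n : ℕ} (T : (Fin n → ℝ) →L[ℝ] F) {q : ℝ} (hq : 2 ≤ q) {K : ℝ} (hK : 0 < K)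
    (hKs : ∀ s : ℝ, 0 ≤ s → s ^ (2 * q) ≤ K * Real.cosh s)
    (l : Fin n → ℝ) (hl : ∀ t, 0 ≤ l t)
    (hd : ∀ u : Fin n → ℝ, (∀ t, |u t| ≤ 1) → ‖T u‖ ^ q ≤ q * ∑ t, l t * u t ^ 2)
    (x : Fin n → ℝ) {s : ℝ} (hs : 0 < s) :
    ‖T (fun t => if s < |x t| ∧ |x t| ≤ 2 * s then x t else 0)‖
      ≤ 2 * (q * K * ∑ t, l t * Real.cosh (x t)) ^ (1 / q) / s := by
  have hq0 : 0 < q := by linarith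
  set G := ∑ t, l t * Real.cosh (x t) with hG
  have hG0 : 0 ≤ G := Finset.sum_nonneg fun t _ => mul_nonneg (hl t) (Real.cosh_pos _).le
  set u : Fin n → ℝ := fun t => if s < |x t| ∧ |x t| ≤ 2 * s then x t / (2 * s) else 0 with hu
  have e : (fun t => if s < |x t| ∧ |x t| ≤ 2 * s then x t else 0) = (2 * s) • u := by
    funext t
    simp only [hu, Pi.smul_apply, smul_eq_mul]
    split_ifs
    · field_simp
    · simp
  have hu1 : ∀ t, |u t| ≤ 1 := by
    intro t
    simp only [hu]
    split_ifs with h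
    · rw [abs_div, abs_of_pos (show 0 < 2 * s by linarith), div_le_one (by linarith)]
      exact h.2
    · simp
  have hle : ∀ t, l t * u t ^ 2 ≤ l t * (K * Real.cosh (x t) / s ^ (2 * q)) := by
    intro t
    refine mul_le_mul_of_nonneg_left ?_ (hl t)
    have hp : 0 < s ^ (2 * q) := Real.rpow_pos_of_pos hs _
    by_cases h : s < |x t| ∧ |x t| ≤ 2 * s
    · refine ((sq_le_one_iff_abs_le_one _).2 (hu1 t)).trans ?_
      rw [le_div_iff₀ hp, one_mul, ← Real.cosh_abs]
      refine le_trans ?_ (hKs _ (abs_nonneg _))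
      exact Real.rpow_le_rpow hs.le h.1.le (by linarith)
    · have : u t = 0 := by simp only [hu, if_neg h]
      rw [this]
      have := Real.cosh_pos (x t)
      simp only [ne_eq, OfNat.ofNat_ne_zero, not_false_eq_true, zero_pow]
      positivity
  have h1 : ‖T u‖ ^ q ≤ (q * K * G) / s ^ (2 * q) := by
    refine (hd u hu1).trans ?_
    calc q * ∑ t, l t * u t ^ 2 ≤ q * ∑ t, l t * (K * Real.cosh (x t) / s ^ (2 * q)) :=
          mul_le_mul_of_nonneg_left (Finset.sum_le_sum fun t _ => hle t) hq0.le
      _ = (q * K * G) / s ^ (2 * q) := by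
          rw [hG, Finset.mul_sum, Finset.mul_sum, Finset.sum_div]
          exact Finset.sum_congr rfl fun t _ => by ring
  have h2 : ‖T u‖ ≤ (q * K * G) ^ (1 / q) / s ^ 2 := by
    have h3 := Real.rpow_le_rpow (by positivity) h1 (show 0 ≤ 1 / q by positivity)
    rw [← Real.rpow_mul (norm_nonneg _), mul_one_div_cancel hq0.ne', Real.rpow_one,
      Real.div_rpow (by positivity) (by positivity), ← Real.rpow_mul hs.le] at h3
    have : 2 * q * (1 / q) = (2 : ℕ) := by field_simp; norm_num
    rwa [this, Real.rpow_natCast] at h3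
  rw [e, map_smul, norm_smul, Real.norm_eq_abs, abs_of_pos (by linarith)]
  calc 2 * s * ‖T u‖ ≤ 2 * s * ((q * K * G) ^ (1 / q) / s ^ 2) :=
        mul_le_mul_of_nonneg_left h2 (by linarith)
    _ = _ := by field_simp

lemma tail_bound {n : ℕ} (T : (Fin n → ℝ) →L[ℝ] F) (x : Fin n → ℝ) {β : ℝ} (hβ : 0 ≤ β)
    (H : ∀ s : ℝ, 0 < s → ‖T (fun t => if s < |x t| ∧ |x t| ≤ 2 * s then x t else 0)‖ ≤ β / s)
    (N : ℕ) : ∀ s : ℝ, 0 < s → (∀ t, |x t| ≤ 2 ^ N * s) →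
      ‖T (fun t => if s < |x t| then x t else 0)‖ ≤ 2 * β / s := by
  induction N with
  | zero =>
    intro s hs h
    have : (fun t => if s < |x t| then x t else 0) = 0 := by
      funext t
      have := h t
      rw [pow_zero, one_mul] at this
      simp [not_lt.2 this]
    rw [this, map_zero, norm_zero]
    positivity
  | succ N ih =>
    intro s hs h
    have h1 := ih (2 * s) (by linarith) (fun t => (h t).trans (le_of_eq (by ring)))
    have h2 := H s hs
    have e : (fun t => if s < |x t| then x t else 0)
        = (fun t => if s < |x t| ∧ |x t| ≤ 2 * s then x t else 0)
          + (fun t => if 2 * s < |x t| then x t else 0) := by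
      funext t
      simp only [Pi.add_apply]
      by_cases a1 : s < |x t| <;> by_cases a2 : 2 * s < |x t|
      · simp [a1, a2]
      · simp [a1, a2, not_lt.1 a2]
      · exfalso; linarith
      · simp [a1, a2]
    rw [e, map_add]
    refine (norm_add_le _ _).trans ?_
    have e2 : 2 * β / s = β / s + 2 * β / (2 * s) := by field_simp; ring
    rw [e2]
    exact add_le_add h2 h1

lemma extrap {n : ℕ} (T : (Fin n → ℝ) →L[ℝ] F) (x : Fin n → ℝ) {β : ℝ} (hβ : 0 ≤ β)
    (H : ∀ s : ℝ, 0 < s → ‖T (fun t => if s < |x t| ∧ |x t| ≤ 2 * s then x t else 0)‖ ≤ β / s)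
    {R : ℝ} (hR : 0 < R) : ‖T x‖ ≤ ‖T‖ * R + 2 * β / R := by
  obtain ⟨N, hN⟩ := pow_unbounded_of_one_lt (‖x‖ / R) (one_lt_two)
  have h1 := tail_bound T x hβ H N R hR (fun t => by
    rw [div_lt_iff₀ hR] at hN
    exact (norm_le_pi_norm x t).trans hN.le)
  have e : x = (fun t => if R < |x t| then 0 else x t) + (fun t => if R < |x t| then x t else 0) := by
    funext t
    simp only [Pi.add_apply]
    split_ifs <;> simp
  have h2 : ‖T (fun t => if R < |x t| then 0 else x t)‖ ≤ ‖T‖ * R := by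
    refine (T.le_opNorm _).trans (mul_le_mul_of_nonneg_left ?_ (norm_nonneg _))
    rw [pi_norm_le_iff_of_nonneg hR.le]
    intro t
    split_ifs with h
    · simpa using hR.le
    · exact not_lt.1 h
  calc ‖T x‖ = ‖T (fun t => if R < |x t| then 0 else x t)
        + T (fun t => if R < |x t| then x t else 0)‖ := by rw [← map_add, ← e]
    _ ≤ _ := (norm_add_le _ _).trans (add_le_add h2 h1)

lemma linear_sum {q : ℝ} (hq : 2 ≤ q)
    (hcot : ∃ Cq > (0:ℝ), ∀ (k : ℕ) (y : Fin k → F),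
        (∑ j, ‖y j‖ ^ q) ^ (1 / q) ≤ Cq * radNorm y) :
    ∃ C > (0:ℝ), ∀ (n m : ℕ) (T : (Fin n → ℝ) →L[ℝ] F) (x : Fin m → Fin n → ℝ), Adm x →
      (∑ j, ‖T (x j)‖ ^ q) ^ (1 / q) ≤ C * ‖T‖ := by
  obtain ⟨Cq, hCq, hcot⟩ := hcot
  obtain ⟨K, hK, hKs⟩ := cosh_poly q hq
  have hq0 : 0 < q := by linarith
  set κ := (q * K) ^ (1 / q) with hκ
  have hκ0 : 0 < κ := Real.rpow_pos_of_pos (by positivity) _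
  set R := 14 * Cq * κ with hR
  have hR0 : 0 < R := by positivity
  refine ⟨2 * Cq * R, by positivity, fun n m T x hx => ?_⟩
  let A : Set ℝ := {v | ∃ (m : ℕ) (x : Fin m → Fin n → ℝ), Adm x ∧ v = ∑ j, ‖T (x j)‖ ^ q}
  have hA0 : (0:ℝ) ∈ A := ⟨0, fun j => j.elim0, fun t => by simp, by simp⟩
  have hAb : BddAbove A := by
    refine ⟨n * ‖T‖ ^ q, ?_⟩
    rintro v ⟨m, x, hx, rfl⟩
    have h1 : ∀ j, ‖T (x j)‖ ^ q ≤ ‖T‖ ^ q * ∑ t, x j t ^ 2 := by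
      intro j
      have a1 : ‖x j‖ ^ q ≤ ∑ t, x j t ^ 2 := by
        have a0 : ‖x j‖ ≤ 1 := (pi_norm_le_iff_of_nonneg zero_le_one).2 fun t => hx.abs_le j t
        have a2 : ‖x j‖ ^ q ≤ ‖x j‖ ^ (2:ℝ) := by
          rcases (norm_nonneg (x j)).eq_or_lt with h | h
          · rw [← h, Real.zero_rpow hq0.ne']; positivity
          · exact Real.rpow_le_rpow_of_exponent_ge h a0 hq
        refine a2.trans ?_
        have hs0 : 0 ≤ ∑ t, x j t ^ 2 := Finset.sum_nonneg fun _ _ => sq_nonneg _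
        have a3 : ‖x j‖ ≤ Real.sqrt (∑ t, x j t ^ 2) := by
          rw [pi_norm_le_iff_of_nonneg (Real.sqrt_nonneg _)]
          intro t
          rw [Real.norm_eq_abs]
          refine Real.abs_le_sqrt ?_
          exact Finset.single_le_sum (f := fun t => x j t ^ 2) (fun _ _ => sq_nonneg _)
            (Finset.mem_univ t)
        rw [Real.rpow_two]
        calc ‖x j‖ ^ 2 ≤ Real.sqrt (∑ t, x j t ^ 2) ^ 2 := by gcongr
          _ = _ := Real.sq_sqrt hs0
      calc ‖T (x j)‖ ^ q ≤ (‖T‖ * ‖x j‖) ^ q :=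
            Real.rpow_le_rpow (norm_nonneg _) (T.le_opNorm _) hq0.le
        _ = ‖T‖ ^ q * ‖x j‖ ^ q := Real.mul_rpow (norm_nonneg _) (norm_nonneg _)
        _ ≤ _ := mul_le_mul_of_nonneg_left a1 (by positivity)
    calc ∑ j, ‖T (x j)‖ ^ q ≤ ∑ j, ‖T‖ ^ q * ∑ t, x j t ^ 2 := Finset.sum_le_sum fun j _ => h1 j
      _ = ‖T‖ ^ q * ∑ t, ∑ j, x j t ^ 2 := by rw [← Finset.mul_sum, Finset.sum_comm]
      _ ≤ ‖T‖ ^ q * ∑ t : Fin n, 1 :=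
          mul_le_mul_of_nonneg_left (Finset.sum_le_sum fun t _ => hx t) (by positivity)
      _ = n * ‖T‖ ^ q := by simp [mul_comm]
  set S := sSup A with hSdef
  have hS : ∀ (m : ℕ) (x : Fin m → Fin n → ℝ), Adm x → ∑ j, ‖T (x j)‖ ^ q ≤ S :=
    fun m x hx => le_csSup hAb ⟨m, x, hx, rfl⟩
  have hS0 : 0 ≤ S := le_csSup hAb hA0
  have hS' : ∀ δ > 0, ∃ (m : ℕ) (x : Fin m → Fin n → ℝ), Adm x ∧
      S - δ ≤ ∑ j, ‖T (x j)‖ ^ q := by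
    intro δ hδ
    obtain ⟨v, ⟨m, x, hx, rfl⟩, hv⟩ := exists_lt_of_lt_csSup ⟨0, hA0⟩ (sub_lt_self S hδ)
    exact ⟨m, x, hx, hv.le⟩
  suffices hfin : S ^ (1 / q) ≤ 2 * Cq * R * ‖T‖ by
    refine le_trans ?_ hfin
    exact Real.rpow_le_rpow (Finset.sum_nonneg fun _ _ => by positivity) (hS m x hx) (by positivity)
  rcases hS0.eq_or_lt with h0 | hSpos
  · rw [← h0, Real.zero_rpow (by positivity)]; positivity
  obtain ⟨l, hl, hlS, hd⟩ := pisier T hq hS hS'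
  set σ := S ^ (1 / q) with hσ
  have hσ0 : 0 < σ := Real.rpow_pos_of_pos hSpos _
  set W := 2 * ‖T‖ ^ 2 * R ^ 2 + 96 * κ ^ 2 * σ ^ 2 / R ^ 2 with hW
  have hW0 : 0 ≤ W := by positivity
  have key : ∀ (m : ℕ) (x : Fin m → Fin n → ℝ), Adm x →
      av (fun ε => ‖∑ j, sg (ε j) • T (x j)‖ ^ 2) ≤ W := by
    intro m x hx
    let X : (Fin m → Bool) → Fin n → ℝ := fun ε t => ∑ j, sg (ε j) * x j t
    have hX : ∀ ε, ∑ j, sg (ε j) • T (x j) = T (X ε) := by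
      intro ε
      have : X ε = ∑ j, sg (ε j) • x j := by
        funext t; simp [X, Finset.sum_apply]
      rw [this, map_sum]
      simp
    let G : (Fin m → Bool) → ℝ := fun ε => ∑ t, l t * Real.cosh (X ε t)
    have hG0 : ∀ ε, 0 ≤ G ε := fun ε =>
      Finset.sum_nonneg fun t _ => mul_nonneg (hl t) (Real.cosh_pos _).le
    have hG : av G ≤ 2 * S := by
      simp only [G]
      rw [av_sum]
      simp only [av_const_mul]
      calc ∑ t, l t * av (fun ε => Real.cosh (X ε t)) ≤ ∑ t, l t * 2 :=
            Finset.sum_le_sum fun t _ => mul_le_mul_of_nonneg_left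
              (av_cosh_le (fun j => x j t) (hx t)) (hl t)
        _ = 2 * ∑ t, l t := by rw [← Finset.sum_mul, mul_comm]
        _ ≤ 2 * S := by linarith
    have hpt : ∀ ε, ‖∑ j, sg (ε j) • T (x j)‖ ^ 2
        ≤ 2 * ‖T‖ ^ 2 * R ^ 2 + 32 * κ ^ 2 * σ ^ 2 / R ^ 2 * (1 + S⁻¹ * G ε) := by
      intro ε
      rw [hX]
      have h1 := extrap T (X ε) (β := 2 * (q * K * G ε) ^ (1 / q))
        (by have := hG0 ε; positivity)
        (fun s hs => layer T hq hK hKs l hl hd (X ε) hs) hR0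
      set g := S⁻¹ * G ε with hg
      have hg0 : 0 ≤ g := mul_nonneg (inv_nonneg.2 hS0) (hG0 ε)
      have h2 : (q * K * G ε) ^ (1 / q) = κ * σ * g ^ (1 / q) := by
        rw [hκ, hσ, ← Real.mul_rpow (by positivity) hS0, ← Real.mul_rpow (by positivity) hg0, hg]
        congr 1
        field_simp
      have h3 : (g ^ (1 / q)) ^ 2 ≤ 1 + g := by
        rw [← Real.rpow_natCast, ← Real.rpow_mul hg0]
        rcases le_total g 1 with h | h
        · have : g ^ (1 / q * ((2:ℕ):ℝ)) ≤ 1 := Real.rpow_le_one hg0 h (by positivity)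
          linarith
        · have : g ^ (1 / q * ((2:ℕ):ℝ)) ≤ g ^ (1:ℝ) := by
            refine Real.rpow_le_rpow_of_exponent_le h ?_
            push_cast
            rw [one_div, inv_mul_le_iff₀ hq0]; linarith
          rw [Real.rpow_one] at this
          linarith
      rw [h2] at h1
      set b := g ^ (1 / q)
      calc ‖T (X ε)‖ ^ 2 ≤ (‖T‖ * R + 2 * (2 * (κ * σ * b)) / R) ^ 2 := by gcongr
        _ ≤ 2 * (‖T‖ * R) ^ 2 + 2 * (2 * (2 * (κ * σ * b)) / R) ^ 2 := by
            nlinarith [sq_nonneg (‖T‖ * R - 2 * (2 * (κ * σ * b)) / R)]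
        _ = 2 * ‖T‖ ^ 2 * R ^ 2 + 32 * κ ^ 2 * σ ^ 2 / R ^ 2 * b ^ 2 := by field_simp; ring
        _ ≤ _ := by gcongr
    refine (av_mono hpt).trans ?_
    rw [av_add, av_const, av_const_mul, av_add, av_const, av_const_mul, hW]
    have : S⁻¹ * av G ≤ 2 := by
      rw [inv_mul_le_iff₀ hSpos]; linarith
    have h5 : 32 * κ ^ 2 * σ ^ 2 / R ^ 2 * (1 + S⁻¹ * av G)
        ≤ 32 * κ ^ 2 * σ ^ 2 / R ^ 2 * 3 :=
      mul_le_mul_of_nonneg_left (by linarith) (by positivity)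
    have h6 : 32 * κ ^ 2 * σ ^ 2 / R ^ 2 * 3 = 96 * κ ^ 2 * σ ^ 2 / R ^ 2 := by ring
    linarith
  have hσW : σ ≤ Cq * Real.sqrt W := by
    have hSle : S ≤ (Cq * Real.sqrt W) ^ q := by
      refine csSup_le ⟨0, hA0⟩ ?_
      rintro v ⟨m, x, hx, rfl⟩
      have h1 := hcot m (fun j => T (x j))
      rw [radNorm_eq, ← Real.sqrt_eq_rpow] at h1
      have h2 : (∑ j, ‖T (x j)‖ ^ q) ^ (1 / q) ≤ Cq * Real.sqrt W :=
        h1.trans (mul_le_mul_of_nonneg_left (Real.sqrt_le_sqrt (key m x hx)) hCq.le)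
      have hn : 0 ≤ ∑ j, ‖T (x j)‖ ^ q := Finset.sum_nonneg fun _ _ => by positivity
      have h3 := Real.rpow_le_rpow (by positivity) h2 hq0.le
      rwa [← Real.rpow_mul hn, one_div_mul_cancel hq0.ne', Real.rpow_one] at h3
    have h3 := Real.rpow_le_rpow hS0 hSle (show 0 ≤ 1 / q by positivity)
    rwa [← Real.rpow_mul (by positivity), mul_one_div_cancel hq0.ne', Real.rpow_one] at h3
  have hσ2 : σ ^ 2 ≤ Cq ^ 2 * W := by
    calc σ ^ 2 ≤ (Cq * Real.sqrt W) ^ 2 := by gcongr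
      _ = Cq ^ 2 * W := by rw [mul_pow, Real.sq_sqrt hW0]
  have e1 : Cq ^ 2 * (96 * κ ^ 2 * σ ^ 2 / R ^ 2) = 96 / 196 * σ ^ 2 := by
    rw [hR]; field_simp; norm_num
  have h9 : σ ^ 2 ≤ (2 * Cq * R * ‖T‖) ^ 2 := by
    rw [hW, mul_add, e1] at hσ2
    nlinarith [sq_nonneg σ]
  exact (pow_le_pow_iff_left₀ hσ0.le (by positivity) two_ne_zero).1 h9

end

section
set_option linter.unusedSectionVars false
variable {F : Type*} [NormedAddCommGroup F] [NormedSpace ℝ F]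

/-- The `ℓ_q` norm of a finite family. -/
noncomputable def nq (q : ℝ) {m : ℕ} (y : Fin m → F) : ℝ := (∑ j, ‖y j‖ ^ q) ^ (1 / q)

lemma nq_eq {q : ℝ} (hq : 2 ≤ q) {m : ℕ} (y : Fin m → F) :
    ‖(WithLp.toLp (ENNReal.ofReal q) y : PiLp (ENNReal.ofReal q) (fun _ : Fin m => F))‖
      = nq q y := by
  have h : (ENNReal.ofReal q).toReal = q := ENNReal.toReal_ofReal (by linarith)
  rw [PiLp.norm_eq_sum (by rw [h]; linarith), h]
  rfl

lemma nq_fact {q : ℝ} (hq : 2 ≤ q) : Fact (1 ≤ ENNReal.ofReal q) :=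
  ⟨by rw [ENNReal.one_le_ofReal]; linarith⟩

lemma nq_nonneg {q : ℝ} {m : ℕ} (y : Fin m → F) : 0 ≤ nq q y :=
  Real.rpow_nonneg (Finset.sum_nonneg fun _ _ => by positivity) _

lemma nq_mono {q : ℝ} (hq : 2 ≤ q) {m : ℕ} {y z : Fin m → F} (h : ∀ j, ‖y j‖ ≤ ‖z j‖) :
    nq q y ≤ nq q z := by
  unfold nq
  refine Real.rpow_le_rpow (Finset.sum_nonneg fun _ _ => by positivity) ?_
    (by have : 0 < q := by linarith
        positivity)
  exact Finset.sum_le_sum fun j _ => Real.rpow_le_rpow (norm_nonneg _) (h j) (by linarith)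

lemma nq_add {q : ℝ} (hq : 2 ≤ q) {m : ℕ} (y z : Fin m → F) :
    nq q (fun j => y j + z j) ≤ nq q y + nq q z := by
  have := nq_fact hq
  rw [← nq_eq hq, ← nq_eq hq, ← nq_eq hq]
  exact norm_add_le (WithLp.toLp (ENNReal.ofReal q) y : PiLp (ENNReal.ofReal q) (fun _ : Fin m => F))
    (WithLp.toLp (ENNReal.ofReal q) z)

lemma nq_smul {q : ℝ} (hq : 2 ≤ q) {m : ℕ} (c : ℝ) (y : Fin m → F) :
    nq q (fun j => c • y j) = |c| * nq q y := by
  have := nq_fact hq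
  rw [← nq_eq hq, ← nq_eq hq]
  exact norm_smul c (WithLp.toLp (ENNReal.ofReal q) y : PiLp (ENNReal.ofReal q) (fun _ : Fin m => F))

lemma nq_sum {q : ℝ} (hq : 2 ≤ q) {m : ℕ} {ι : Type*} (s : Finset ι) (y : ι → Fin m → F) :
    nq q (fun j => ∑ i ∈ s, y i j) ≤ ∑ i ∈ s, nq q (y i) := by
  classical
  induction s using Finset.induction_on with
  | empty =>
    have : 0 < q := by linarith
    simp [nq, Real.zero_rpow this.ne', Real.zero_rpow (inv_pos.2 this).ne']
  | insert a s ha ih =>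
    simp only [Finset.sum_insert ha]
    exact (nq_add hq _ _).trans (by linarith)

lemma le_nq {q : ℝ} (hq : 2 ≤ q) {m : ℕ} (y : Fin m → F) (j : Fin m) : ‖y j‖ ≤ nq q y := by
  have := nq_fact hq
  rw [← nq_eq hq]
  exact PiLp.norm_apply_le
    (WithLp.toLp (ENNReal.ofReal q) y : PiLp (ENNReal.ofReal q) (fun _ : Fin m => F)) j

lemma nq_le_sum {q : ℝ} (hq : 2 ≤ q) {m : ℕ} (y : Fin m → F) {B : ℝ}
    (h : ∀ j, ‖y j‖ ≤ B) : nq q y ≤ (m * B ^ q) ^ (1 / q) := by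
  unfold nq
  refine Real.rpow_le_rpow (Finset.sum_nonneg fun _ _ => by positivity) ?_
    (by have : 0 < q := by linarith
        positivity)
  calc ∑ j, ‖y j‖ ^ q ≤ ∑ j : Fin m, B ^ q :=
        Finset.sum_le_sum fun j _ => Real.rpow_le_rpow (norm_nonneg _) (h j) (by linarith)
    _ = _ := by simp

lemma groth {q : ℝ} (hq : 2 ≤ q) {n m : ℕ} (L : Fin m → (Fin n → ℝ) →ₗ[ℝ] F) {B : ℝ}
    (hB : ∀ z : Fin n → ℝ, ‖z‖ ≤ 1 → nq q (fun j => L j z) ≤ B)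
    (y : Fin m → Fin n → ℝ) (hy : Adm y) : nq q (fun j => L j (y j)) ≤ 40 * B := by
  let A : Set ℝ := {v | ∃ y : Fin m → Fin n → ℝ, Adm y ∧ v = nq q (fun j => L j (y j))}
  have hAb : BddAbove A := by
    refine ⟨(m * B ^ q) ^ (1 / q), ?_⟩
    rintro v ⟨y, hy, rfl⟩
    refine nq_le_sum hq _ fun j => ?_
    refine (le_nq hq (fun i => L i (y j)) j).trans (hB _ ?_)
    exact (pi_norm_le_iff_of_nonneg zero_le_one).2 fun t => hy.abs_le j t
  have hAne : A.Nonempty := ⟨_, y, hy, rfl⟩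
  have hbig : ∀ z : Fin n → ℝ, ‖z‖ ≤ 20 → nq q (fun j => L j z) ≤ 20 * B := by
    intro z hz
    have h1 := hB ((20:ℝ)⁻¹ • z) (by
      rw [norm_smul, Real.norm_eq_abs, abs_of_pos (by norm_num)]; linarith)
    simp only [map_smul] at h1
    rw [nq_smul hq, abs_of_pos (by norm_num)] at h1
    linarith
  have step : ∀ v ∈ A, v ≤ 20 * B + 1 / 2 * sSup A := by
    rintro v ⟨y, hy, rfl⟩
    let X : (Fin m → Bool) → Fin n → ℝ := fun ε t => ∑ j, sg (ε j) * y j t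
    let z : (Fin m → Bool) → Fin n → ℝ := fun ε t => if |X ε t| ≤ 20 then X ε t else 0
    let w : (Fin m → Bool) → Fin n → ℝ := fun ε t => if |X ε t| ≤ 20 then 0 else X ε t
    let v : Fin m → Fin n → ℝ := fun j t => av (fun ε => sg (ε j) * w ε t)
    have hz : ∀ ε, ‖z ε‖ ≤ 20 := by
      intro ε
      rw [pi_norm_le_iff_of_nonneg (by norm_num)]
      intro t
      simp only [z]
      split_ifs with h
      · exact h
      · simp
    have hyj : ∀ j, y j = (2 ^ m : ℝ)⁻¹ • (∑ ε, sg (ε j) • z ε) + v j := by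
      intro j
      funext t
      have e1 : ((2 ^ m : ℝ)⁻¹ • (∑ ε, sg (ε j) • z ε)) t = av (fun ε => sg (ε j) * z ε t) := by
        simp [av, Finset.sum_apply]
      have e2 : y j t = av (fun ε => sg (ε j) * X ε t) := by
        have : (fun ε : Fin m → Bool => sg (ε j) * X ε t)
            = fun ε => ∑ i, y i t * (sg (ε j) * sg (ε i)) := by
          funext ε
          simp only [X]
          rw [Finset.mul_sum]
          exact Finset.sum_congr rfl fun _ _ => by ring
        rw [this, av_sum]
        simp only [av_const_mul, av_sg_mul]
        simp
      rw [Pi.add_apply, e1, e2, ← av_add]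
      congr 1
      funext ε
      simp only [z, w]
      split_ifs <;> simp
    have hv : Adm (fun j => (2:ℝ) • v j) := by
      intro t
      have h1 := bessel (fun ε => w ε t)
      have h2 : av (fun ε => w ε t ^ 2) ≤ av (fun ε => 48 / 400 * Real.cosh (X ε t)) := by
        refine av_mono fun ε => ?_
        simp only [w]
        have hc := Real.cosh_pos (X ε t)
        split_ifs with h
        · rw [zero_pow two_ne_zero]; positivity
        · have h4 := Real.pow_div_factorial_le_exp |X ε t| (abs_nonneg _) 4
          have h5 : Real.exp |X ε t| ≤ 2 * Real.cosh (X ε t) := by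
            rw [← Real.cosh_abs, Real.cosh_eq]; linarith [Real.exp_pos (-|X ε t|)]
          have h6 : ((Nat.factorial 4 : ℕ) : ℝ) = 24 := by norm_num [Nat.factorial]
          rw [h6] at h4
          have h7 : 400 ≤ |X ε t| ^ 2 := by nlinarith [not_le.1 h]
          rw [← sq_abs]
          nlinarith [sq_nonneg |X ε t|]
      rw [av_const_mul] at h2
      have h3 := av_cosh_le (fun j => y j t) (hy t)
      have h8 : ∑ j, ((fun j => (2:ℝ) • v j) j t) ^ 2
          = 4 * ∑ j, (av (fun ε => sg (ε j) * w ε t)) ^ 2 := by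
        rw [Finset.mul_sum]
        refine Finset.sum_congr rfl fun j _ => ?_
        simp only [Pi.smul_apply, smul_eq_mul, v]
        ring
      rw [h8]
      change av (fun ε => Real.cosh (X ε t)) ≤ 2 at h3
      linarith
    have hLv : nq q (fun j => L j (v j)) ≤ 1 / 2 * sSup A := by
      have h1 : nq q (fun j => L j ((2:ℝ) • v j)) ≤ sSup A :=
        le_csSup hAb ⟨_, hv, rfl⟩
      simp only [map_smul] at h1
      rw [nq_smul hq, abs_of_pos (by norm_num)] at h1
      linarith
    have hLz : nq q (fun j => (2 ^ m : ℝ)⁻¹ • ∑ ε : Fin m → Bool, sg (ε j) • L j (z ε)) ≤ 20 * B := by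
      rw [nq_smul hq, abs_of_pos (by positivity)]
      have h1 : ∀ ε : Fin m → Bool, nq q (fun j => sg (ε j) • L j (z ε)) ≤ 20 * B := by
        intro ε
        refine le_trans (nq_mono hq fun j => ?_) (hbig (z ε) (hz ε))
        rw [norm_smul, Real.norm_eq_abs, abs_sg, one_mul]
      have h2 := (nq_sum hq Finset.univ (fun (ε : Fin m → Bool) j => sg (ε j) • L j (z ε))).trans
        (Finset.sum_le_sum fun ε _ => h1 ε)
      have h3 : ∑ _ε : Fin m → Bool, 20 * B = 2 ^ m * (20 * B) := by simp
      rw [h3] at h2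
      rwa [inv_mul_le_iff₀ (by positivity)]
    have e : (fun j => L j (y j)) = fun j =>
        ((2 ^ m : ℝ)⁻¹ • ∑ ε : Fin m → Bool, sg (ε j) • L j (z ε)) + L j (v j) := by
      funext j
      conv_lhs => rw [hyj j]
      rw [map_add, map_smul, map_sum]
      simp only [map_smul]
    rw [e]
    exact (nq_add hq _ _).trans (add_le_add hLz hLv)
  have h1 : sSup A ≤ 20 * B + 1 / 2 * sSup A := csSup_le hAne step
  have h2 : nq q (fun j => L j (y j)) ≤ sSup A := le_csSup hAb ⟨y, hy, rfl⟩
  linarith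

lemma multi {q : ℝ} (hq : 2 ≤ q) {C : ℝ} (hC : 0 < C)
    (hlin : ∀ (n m : ℕ) (T : (Fin n → ℝ) →L[ℝ] F) (x : Fin m → Fin n → ℝ), Adm x →
      nq q (fun j => T (x j)) ≤ C * ‖T‖) (n m k : ℕ) :
    ∀ (A : ContinuousMultilinearMap ℝ (fun _ : Fin (k+1) => (Fin n → ℝ)) F)
      (x : Fin (k+1) → Fin m → Fin n → ℝ), (∀ i, Adm (x i)) →
      nq q (fun j => A (fun i => x i j)) ≤ C * 40 ^ k * ‖A‖ := by
  induction k with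
  | zero =>
    intro A x hx
    have h1 := hlin n m (A.toContinuousLinearMap 0 0) (x 0) (hx 0)
    have e : ∀ z : Fin n → ℝ, Function.update (0 : Fin 1 → Fin n → ℝ) 0 z = fun _ => z := by
      intro z; funext i; fin_cases i; simp
    have e2 : ∀ j, (fun i => x i j) = fun _ => x 0 j := by
      intro j; funext i; fin_cases i; rfl
    have h2 : ‖A.toContinuousLinearMap 0 0‖ ≤ ‖A‖ := by
      refine ContinuousLinearMap.opNorm_le_bound _ (norm_nonneg _) fun z => ?_
      have := A.le_opNorm (fun _ => z)
      change ‖A (Function.update 0 0 z)‖ ≤ _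
      rw [e]
      simpa using this
    have h3 : (fun j => A (fun i => x i j)) = fun j => A.toContinuousLinearMap 0 0 (x 0 j) := by
      funext j
      change _ = A (Function.update 0 0 (x 0 j))
      rw [e, e2]
    rw [h3, pow_zero, mul_one]
    exact h1.trans (mul_le_mul_of_nonneg_left h2 hC.le)
  | succ k ih =>
    intro A x hx
    let L : Fin m → (Fin n → ℝ) →ₗ[ℝ] F := fun j =>
      { toFun := fun z => A.curryLeft z (fun i => x i.succ j)
        map_add' := fun a b => by rw [map_add]; rfl
        map_smul' := fun a b => by rw [map_smul]; rfl }
    have h1 := groth hq L (B := C * 40 ^ k * ‖A‖) (fun z hz => ?_) (x 0) (hx 0)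
    · have e : (fun j => A (fun i => x i j)) = fun j => L j (x 0 j) := by
        funext j
        change _ = A (Fin.cons (x 0 j) (fun i => x i.succ j))
        congr 1
        funext i
        refine Fin.cases ?_ (fun i => ?_) i <;> simp
      rw [e]
      refine h1.trans (le_of_eq ?_)
      ring
    · refine (ih (A.curryLeft z) (fun i => x i.succ) (fun i => hx i.succ)).trans ?_
      refine mul_le_mul_of_nonneg_left ?_ (by positivity)
      refine (A.curryLeft.le_opNorm z).trans ?_
      rw [ContinuousMultilinearMap.curryLeft_norm]
      exact mul_le_of_le_one_right (norm_nonneg _) hz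

lemma multi_scaled {q : ℝ} (hq : 2 ≤ q) {C : ℝ} (hC : 0 < C)
    (hlin : ∀ (n m : ℕ) (T : (Fin n → ℝ) →L[ℝ] F) (x : Fin m → Fin n → ℝ), Adm x →
      nq q (fun j => T (x j)) ≤ C * ‖T‖) (n m k : ℕ)
    (A : ContinuousMultilinearMap ℝ (fun _ : Fin (k+1) => (Fin n → ℝ)) F)
    (x : Fin m → Fin n → ℝ) {c : ℝ} (hc : 0 ≤ c) (hx : ∀ t, ∑ j, x j t ^ 2 ≤ c ^ 2) :
    nq q (fun j => A (fun _ => x j)) ≤ C * 40 ^ k * ‖A‖ * c ^ (k + 1) := by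
  rcases hc.eq_or_lt with h0 | hc0
  · have hx0 : ∀ j, x j = 0 := by
      intro j; funext t
      have h1 : x j t ^ 2 ≤ ∑ j, x j t ^ 2 :=
        Finset.single_le_sum (f := fun j => x j t ^ 2) (fun _ _ => sq_nonneg _) (Finset.mem_univ j)
      have h2 := h1.trans (hx t)
      rw [← h0] at h2
      have : x j t ^ 2 = 0 := le_antisymm (by simpa using h2) (sq_nonneg _)
      simpa using this
    have : ∀ j, A (fun _ => x j) = 0 := fun j => A.map_coord_zero (0 : Fin (k+1)) (hx0 j)
    simp only [this]
    have hq0 : 0 < q := by linarith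
    simp only [nq, norm_zero, Real.zero_rpow hq0.ne', Finset.sum_const_zero]
    rw [Real.zero_rpow (by positivity)]
    positivity
  · have h1 := multi hq hC hlin n m k A (fun _ j => c⁻¹ • x j) (fun _ t => by
      simp only [Pi.smul_apply, smul_eq_mul, mul_pow, ← Finset.mul_sum]
      rw [inv_pow, inv_mul_le_iff₀ (by positivity), mul_one]
      exact hx t)
    have e : ∀ j, A (fun _ => c⁻¹ • x j) = (c⁻¹) ^ (k+1) • A (fun _ => x j) := by
      intro j
      have := A.map_smul_univ (fun _ => c⁻¹) (fun _ => x j)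
      simpa using this
    simp only [e] at h1
    rw [nq_smul hq, abs_of_pos (by positivity), inv_pow, inv_mul_le_iff₀ (by positivity)] at h1
    linarith

variable {E : Type*} [NormedAddCommGroup E] [NormedSpace ℝ E]

lemma weak_bdd {m : ℕ} (x : Fin m → E) :
    BddAbove {s : ℝ | ∃ φ : E →L[ℝ] ℝ, ‖φ‖ ≤ 1 ∧ s = (∑ j, |φ (x j)| ^ (2:ℝ)) ^ (1 / (2:ℝ))} := by
  refine ⟨(∑ j, ‖x j‖ ^ (2:ℝ)) ^ (1 / (2:ℝ)), ?_⟩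
  rintro s ⟨φ, hφ, rfl⟩
  refine Real.rpow_le_rpow (Finset.sum_nonneg fun _ _ => by positivity) ?_ (by norm_num)
  refine Finset.sum_le_sum fun j _ => Real.rpow_le_rpow (abs_nonneg _) ?_ (by norm_num)
  exact (φ.le_opNorm _).trans (mul_le_of_le_one_left (norm_nonneg _) hφ)

lemma weak_one {m : ℕ} (x : Fin m → E) (φ : E →L[ℝ] ℝ) (hφ : ‖φ‖ ≤ 1) :
    ∑ j, φ (x j) ^ 2 ≤ weakNorm 2 x ^ 2 ∧ 0 ≤ weakNorm 2 x := by
  have h1 : (∑ j, |φ (x j)| ^ (2:ℝ)) ^ (1 / (2:ℝ)) ≤ weakNorm 2 x :=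
    le_csSup (weak_bdd x) ⟨φ, hφ, rfl⟩
  have h2 : (∑ j, |φ (x j)| ^ (2:ℝ)) = ∑ j, φ (x j) ^ 2 :=
    Finset.sum_congr rfl fun j _ => by rw [Real.rpow_two, sq_abs]
  have h0 : 0 ≤ ∑ j, φ (x j) ^ 2 := Finset.sum_nonneg fun _ _ => sq_nonneg _
  rw [h2, ← Real.sqrt_eq_rpow] at h1
  refine ⟨?_, (Real.sqrt_nonneg _).trans h1⟩
  calc _ = Real.sqrt (∑ j, φ (x j) ^ 2) ^ 2 := (Real.sq_sqrt h0).symm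
    _ ≤ _ := by gcongr

lemma weak_nonneg {m : ℕ} (x : Fin m → E) : 0 ≤ weakNorm 2 x := (weak_one x 0 (by simp)).2

lemma weak_le {m : ℕ} (x : Fin m → E) (φ : E →L[ℝ] ℝ) {c : ℝ} (hφ : ‖φ‖ ≤ c) :
    ∑ j, φ (x j) ^ 2 ≤ (c * weakNorm 2 x) ^ 2 := by
  have hc : 0 ≤ c := (norm_nonneg _).trans hφ
  rcases hc.eq_or_lt with h | h
  · have : φ = 0 := norm_le_zero_iff.1 (h ▸ hφ)
    rw [this]; simp; positivity
  · have h1 := (weak_one x (c⁻¹ • φ) (by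
      rw [norm_smul, Real.norm_eq_abs, abs_of_pos (by positivity), inv_mul_le_iff₀ h]
      linarith)).1
    simp only [smul_apply, smul_eq_mul, mul_pow, ← Finset.mul_sum] at h1
    rw [inv_pow, inv_mul_le_iff₀ (by positivity)] at h1
    rw [mul_pow]; exact h1

lemma norm_le_weak {m : ℕ} (x : Fin m → E) (j : Fin m) : ‖x j‖ ≤ weakNorm 2 x := by
  obtain ⟨g, hg, hgx⟩ := exists_dual_vector'' ℝ (x j)
  have h1 := (weak_one x g hg).1
  have h2 : g (x j) ^ 2 ≤ ∑ j, g (x j) ^ 2 :=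
    Finset.single_le_sum (f := fun j => g (x j) ^ 2) (fun _ _ => sq_nonneg _) (Finset.mem_univ j)
  rw [hgx] at h2
  simp only [RCLike.ofReal_real_eq_id, id] at h2
  exact (pow_le_pow_iff_left₀ (norm_nonneg _) (weak_nonneg x) two_ne_zero).1 (h2.trans h1)

lemma poly_sum {lam : ℝ} (hE : IsLinftySpace lam E) {q : ℝ} (hq : 2 ≤ q) {C : ℝ} (hC : 0 < C)
    (hlin : ∀ (n m : ℕ) (T : (Fin n → ℝ) →L[ℝ] F) (x : Fin m → Fin n → ℝ), Adm x →
      nq q (fun j => T (x j)) ≤ C * ‖T‖) (m k : ℕ)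
    (A : ContinuousMultilinearMap ℝ (fun _ : Fin (k+1) => E) F) (x : Fin m → E) :
    nq q (fun j => A (fun _ => x j)) ≤ C * 40 ^ k * ‖A‖ * (lam * weakNorm 2 x) ^ (k + 1) := by
  obtain ⟨H, hGH, hfd, n, e, he⟩ := hE (Submodule.span ℝ (Set.range x))
    (FiniteDimensional.span_of_finite ℝ (Set.finite_range x))
  have hxH : ∀ j, x j ∈ H := fun j => hGH (Submodule.subset_span ⟨j, rfl⟩)
  let x' : Fin m → H := fun j => ⟨x j, hxH j⟩
  set a := ‖(e : H →L[ℝ] (Fin n → ℝ))‖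
  set b := ‖(e.symm : (Fin n → ℝ) →L[ℝ] H)‖
  have ha0 : 0 ≤ a := norm_nonneg (e : H →L[ℝ] (Fin n → ℝ))
  have hb0 : 0 ≤ b := norm_nonneg (e.symm : (Fin n → ℝ) →L[ℝ] H)
  have hw := weak_nonneg x
  have hco : ∀ t, ∑ j, (e (x' j)) t ^ 2 ≤ (a * weakNorm 2 x) ^ 2 := by
    intro t
    let ψ : H →L[ℝ] ℝ := (ContinuousLinearMap.proj t).comp (e : H →L[ℝ] (Fin n → ℝ))
    have hψ : ‖ψ‖ ≤ a := by
      refine ContinuousLinearMap.opNorm_le_bound _ ha0 fun z => ?_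
      exact (norm_le_pi_norm (e z) t).trans ((e : H →L[ℝ] (Fin n → ℝ)).le_opNorm z)
    obtain ⟨φ, h1, h2⟩ := exists_extension_norm_eq H ψ
    have h3 := weak_le x φ (h2.le.trans hψ)
    have h4 : ∀ j, φ (x j) = (e (x' j)) t := fun j => h1 (x' j)
    simpa only [h4] using h3
  let S : (Fin n → ℝ) →L[ℝ] E := H.subtypeL.comp (e.symm : (Fin n → ℝ) →L[ℝ] H)
  have hS : ‖S‖ ≤ b := by
    refine ContinuousLinearMap.opNorm_le_bound _ hb0 fun z => ?_
    exact (e.symm : (Fin n → ℝ) →L[ℝ] H).le_opNorm z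
  have hSx : ∀ j, S (e (x' j)) = x j := by
    intro j
    change ((e.symm (e (x' j)) : H) : E) = x j
    rw [e.symm_apply_apply]
  have h1 := multi_scaled hq hC hlin n m k (A.compContinuousLinearMap (fun _ => S))
    (fun j => e (x' j)) (c := a * weakNorm 2 x) (by positivity) hco
  have h2 : (fun j => (A.compContinuousLinearMap (fun _ => S)) (fun _ => e (x' j)))
      = fun j => A (fun _ => x j) := by
    funext j
    rw [ContinuousMultilinearMap.compContinuousLinearMap_apply]
    simp only [hSx]
  rw [h2] at h1
  have h3 : ‖A.compContinuousLinearMap (fun _ => S)‖ ≤ ‖A‖ * b ^ (k + 1) := by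
    refine (ContinuousMultilinearMap.norm_compContinuousLinearMap_le _ _).trans ?_
    rw [Finset.prod_const, Finset.card_univ, Fintype.card_fin]
    gcongr
  refine h1.trans ?_
  have hab : 0 ≤ a * b := by positivity
  calc C * 40 ^ k * ‖A.compContinuousLinearMap (fun _ => S)‖ * (a * weakNorm 2 x) ^ (k + 1)
      ≤ C * 40 ^ k * (‖A‖ * b ^ (k + 1)) * (a * weakNorm 2 x) ^ (k + 1) := by gcongr
    _ = C * 40 ^ k * ‖A‖ * ((a * b) * weakNorm 2 x) ^ (k + 1) := by
        simp only [mul_pow]; ring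
    _ ≤ _ := by gcongr

end

theorem stmt14 {E F : Type*} [NormedAddCommGroup E] [NormedSpace ℝ E]
    [NormedAddCommGroup F] [NormedSpace ℝ F]
    (lam : ℝ) (hlam : 1 ≤ lam) (hE : IsLinftySpace lam E)
    (q : ℝ) (hq : 2 ≤ q)
    (hcot : ∃ Cq > (0:ℝ), ∀ (k : ℕ) (y : Fin k → F),
        (∑ j, ‖y j‖ ^ q) ^ (1 / q) ≤ Cq * radNorm y)
    (f : E → F) (a : E) (hf : AnalyticAt ℝ f a) :
    ∃ M > (0:ℝ), ∃ δ > (0:ℝ), ∀ (m : ℕ) (x : Fin m → E), weakNorm 2 x < δ →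
      (∑ j, ‖f (a + x j) - f a‖ ^ q) ^ (1 / q) ≤ M * weakNorm 2 x := by 
  have hq0 : 0 < q := by linarith
  obtain ⟨C, hC, hlin⟩ := linear_sum hq hcot
  obtain ⟨p, r, hp⟩ := hf
  obtain ⟨ρ, hρ0, hρr⟩ := ENNReal.lt_iff_exists_nnreal_btwn.1 hp.r_pos
  have hρ : (0:ℝ) < ρ := by exact_mod_cast hρ0
  obtain ⟨C0, hC0, hpn⟩ := p.norm_mul_pow_le_of_lt_radius (hρr.trans_le hp.r_le)
  have hlam0 : 0 < lam := by linarith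
  refine ⟨2 * (C * C0 * (lam / ρ)), by positivity, min (ρ:ℝ) (ρ / (80 * lam)),
    lt_min hρ (by positivity), fun m x hx => ?_⟩
  have hw := weak_nonneg x
  set w := weakNorm 2 x with hwdef
  have hw1 : w < ρ := hx.trans_le (min_le_left _ _)
  have hw2 : w * (80 * lam) ≤ ρ := by
    have := (hx.trans_le (min_le_right _ _)).le
    rwa [le_div_iff₀ (by positivity)] at this
  have hsum : ∀ j, HasSum (fun k => p (k+1) (fun _ => x j)) (f (a + x j) - f a) := by
    intro j
    have hmem : x j ∈ Metric.eball (0:E) r := by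
      rw [Metric.mem_eball, edist_zero_right]
      refine lt_trans ?_ hρr
      have h1 : ‖x j‖ < ρ := (norm_le_weak x j).trans_lt hw1
      have h2 : ‖x j‖₊ < ρ := by exact_mod_cast h1
      rw [enorm_eq_nnnorm]
      exact_mod_cast h2
    have h1 := hp.hasSum hmem
    have h2 := (hasSum_nat_add_iff' 1).2 h1
    simpa [hp.coeff_zero] using h2
  have hfact := nq_fact hq
  have hS : HasSum (fun k => (WithLp.toLp (ENNReal.ofReal q) (fun j => p (k+1) (fun _ => x j)) :
      PiLp (ENNReal.ofReal q) (fun _ : Fin m => F)))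
      (WithLp.toLp (ENNReal.ofReal q) (fun j => f (a + x j) - f a)) := by
    have h1 : HasSum (fun k => (fun j => p (k+1) (fun _ => x j) : Fin m → F))
      (fun j => f (a + x j) - f a) := Pi.hasSum.2 hsum
    exact h1.mapL
      ((PiLp.continuousLinearEquiv (ENNReal.ofReal q) ℝ (fun _ : Fin m => F)).symm :
        (Fin m → F) →L[ℝ] PiLp (ENNReal.ofReal q) (fun _ : Fin m => F))
  have hgeo : HasSum (fun k : ℕ => C * C0 * (lam / ρ) * w * (1 / 2 : ℝ) ^ k)
      (C * C0 * (lam / ρ) * w * 2) := hasSum_geometric_two.mul_left _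
  have hfin := hS.norm_le_of_bounded hgeo (fun k => by
    rw [nq_eq hq]
    refine (poly_sum hE hq hC hlin m k (p (k+1)) x).trans ?_
    rw [← hwdef]
    have h1 : ‖p (k+1)‖ ≤ C0 / (ρ:ℝ) ^ (k+1) := by
      rw [le_div_iff₀ (by positivity)]; exact hpn (k+1)
    have h2 : 40 * (lam * w / ρ) ≤ 1 / 2 := by
      rw [← mul_div_assoc, div_le_iff₀ hρ]; linarith
    calc C * 40 ^ k * ‖p (k+1)‖ * (lam * w) ^ (k+1)
        ≤ C * 40 ^ k * (C0 / (ρ:ℝ) ^ (k+1)) * (lam * w) ^ (k+1) := by gcongr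
      _ = C * C0 * (lam / ρ) * w * (40 * (lam * w / ρ)) ^ k := by
          rw [mul_pow 40, div_pow, pow_succ, pow_succ]; field_simp
      _ ≤ _ := by gcongr)
  rw [nq_eq hq] at hfin
  refine le_trans (le_of_eq rfl) (hfin.trans (le_of_eq ?_))
  ring
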